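/- arXiv:1910.01182 — 4 statements merged into one kernel-verified Lean document; each statement's English description precedes it below -/
import Mathlib

section
/- (Lemma 3.2) With the geometric mutual information quantities defined in the context, one has I(F;X|C) ≥ I((F,C);X) − 2·Σ_c p(c) ∫∫ φ(c)(y,x) · φ_X(c)(x)/(f_X(x) + φ_X(c)(x)) dy dx, i.e., I(F;X|C) ≥ I((F,C);X) − 2·E_f[(f(X)/f(X|C) + 1)⁻¹]. -/
open MeasureTheory

theorem aux_pt (a b g h : ℝ) (ha : 0 < a) (hb : 0 ≤ b) (hg : 0 ≤ g) (hh : 0 ≤ h) :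
    a * b * g / (a + b * g) ≤ a * b * h / (a + b * h) + a * g / (h + g) := by
  rcases hg.eq_or_lt with rfl | hg'
  · simp only [mul_zero, zero_div, add_zero]
    positivity
  · have h1 : 0 < a + b * g := by positivity
    have h2 : 0 < a + b * h := by positivity
    have h3 : 0 < h + g := by positivity
    rw [div_add_div _ _ h2.ne' h3.ne', div_le_div_iff₀ h1 (mul_pos h2 h3)]
    have : 0 ≤ a * (a * b * h * (h + g) + g * a ^ 2 + b ^ 2 * g ^ 2 * h) := by positivity
    nlinarith [this]

/-- Lemma 3.2: with the geometric mutual information quantities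
defined by the density setup below,
`I(F;X|C) ≥ I((F,C);X) − 2·Σ_c p(c) ∫∫ φ(c)(y,x)·φ_X(c)(x)/(f_X(x) + φ_X(c)(x))`. -/
theorem stmt_4
    (m : ℕ) (hm : 1 ≤ m)
    (p : Fin m → ℝ) (hp : ∀ c, 0 < p c) (hpsum : ∑ c, p c = 1)
    (φ : Fin m → ℝ → ℝ → ℝ)
    (hφmeas : ∀ c, Measurable (Function.uncurry (φ c)))
    (hφpos : ∀ c y x, 0 < φ c y x)
    (hφint : ∀ c, ∫ z : ℝ × ℝ, φ c z.1 z.2 = 1)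
    (hφinteg : ∀ c, Integrable (fun z : ℝ × ℝ => φ c z.1 z.2))
    (φF φX : Fin m → ℝ → ℝ)
    (hφF : ∀ c y, φF c y = ∫ x, φ c y x)
    (hφX : ∀ c x, φX c x = ∫ y, φ c y x)
    (fX : ℝ → ℝ) (hfX : ∀ x, fX x = ∑ c, p c * φX c x)
    -- all displayed integrals are finite:
    (hI1 : ∀ c, Integrable (fun z : ℝ × ℝ =>
      φ c z.1 z.2 * φF c z.1 * φX c z.2 / (φ c z.1 z.2 + φF c z.1 * φX c z.2)))
    (hI2 : ∀ c, Integrable (fun z : ℝ × ℝ =>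
      φ c z.1 z.2 * φF c z.1 * fX z.2 / (φ c z.1 z.2 + φF c z.1 * fX z.2)))
    (hI3 : ∀ c, Integrable (fun z : ℝ × ℝ =>
      φ c z.1 z.2 * φX c z.2 / (fX z.2 + φX c z.2))) :
    -- I(F;X|C) ≥ I((F,C);X) − 2·E_f[(f(X)/f(X|C) + 1)⁻¹]
    1 - 2 * ∑ c, p c * ∫ z : ℝ × ℝ,
        φ c z.1 z.2 * φF c z.1 * φX c z.2 / (φ c z.1 z.2 + φF c z.1 * φX c z.2) ≥
      (1 - 2 * ∑ c, p c * ∫ z : ℝ × ℝ,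
        φ c z.1 z.2 * φF c z.1 * fX z.2 / (φ c z.1 z.2 + φF c z.1 * fX z.2)) -
      2 * ∑ c, p c * ∫ z : ℝ × ℝ,
        φ c z.1 z.2 * φX c z.2 / (fX z.2 + φX c z.2) := by
  have hF : ∀ c y, 0 ≤ φF c y := fun c y => by
    rw [hφF]; exact integral_nonneg fun x => (hφpos c y x).le
  have hX : ∀ c x, 0 ≤ φX c x := fun c x => by
    rw [hφX]; exact integral_nonneg fun y => (hφpos c y x).le
  have hf : ∀ x, 0 ≤ fX x := fun x => by
    rw [hfX]; exact Finset.sum_nonneg fun c _ => mul_nonneg (hp c).le (hX c x)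
  have key := Finset.sum_le_sum fun c (_ : c ∈ Finset.univ) =>
    mul_le_mul_of_nonneg_left
      ((integral_mono (hI1 c) ((hI2 c).add (hI3 c)) fun z =>
        aux_pt _ _ _ _ (hφpos c z.1 z.2) (hF c z.1) (hX c z.2) (hf z.2)).trans_eq
        (integral_add (hI2 c) (hI3 c))) (hp c).le
  simp only [mul_add, Finset.sum_add_distrib] at key
  linarith
end

section
/- (Lemma 3.3) Assume in addition to the setup in the context that (i) F and C are independent, i.e., φ_F(c)(y) = f_F(y) for every class c and (Lebesgue-)a.e. y, and (ii) for every class c and a.e. (y,x) one has f_FX(y,x)·φ_X(c)(x) ≥ f_F(y)·(f_X(x))² (this is the paper's condition f(F_i|x)·f(c|x) ≥ f(F_i)·f(c) written in terms of densities). Then there exists δ̃ ≥ 0 such that I((F,C);X) ≥ I(F;C|X) + δ̃; in particular I((F,C);X) ≥ I(F;C|X). -/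
open MeasureTheory

/-- Lemma 3.3: under (i) independence of `F` and `C`
(`φ_F(c) = f_F` a.e. for each `c`) and (ii) `f_FX(y,x)·φ_X(c)(x) ≥ f_F(y)·(f_X(x))²`
a.e. for each `c`, there exists `δ̃ ≥ 0` with `I((F,C);X) ≥ I(F;C|X) + δ̃`;
in particular `I((F,C);X) ≥ I(F;C|X)`. -/
theorem stmt_6
    (m : ℕ) (hm : 1 ≤ m)
    (p : Fin m → ℝ) (hp : ∀ c, 0 < p c) (hpsum : ∑ c, p c = 1)
    (φ : Fin m → ℝ → ℝ → ℝ)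
    (hφmeas : ∀ c, Measurable (Function.uncurry (φ c)))
    (hφpos : ∀ c y x, 0 < φ c y x)
    (hφint : ∀ c, ∫ z : ℝ × ℝ, φ c z.1 z.2 = 1)
    (hφinteg : ∀ c, Integrable (fun z : ℝ × ℝ => φ c z.1 z.2))
    (φF φX : Fin m → ℝ → ℝ)
    (hφF : ∀ c y, φF c y = ∫ x, φ c y x)
    (hφX : ∀ c x, φX c x = ∫ y, φ c y x)
    (fF : ℝ → ℝ) (hfF : ∀ y, fF y = ∑ c, p c * φF c y)
    (fX : ℝ → ℝ) (hfX : ∀ x, fX x = ∑ c, p c * φX c x)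
    (fFX : ℝ → ℝ → ℝ) (hfFX : ∀ y x, fFX y x = ∑ c, p c * φ c y x)
    -- all displayed integrals are finite:
    (hI2 : ∀ c, Integrable (fun z : ℝ × ℝ =>
      φ c z.1 z.2 * φF c z.1 * fX z.2 / (φ c z.1 z.2 + φF c z.1 * fX z.2)))
    (hI4 : ∀ c, Integrable (fun z : ℝ × ℝ =>
      φ c z.1 z.2 * fFX z.1 z.2 * φX c z.2 / (φ c z.1 z.2 * fX z.2 + fFX z.1 z.2 * φX c z.2)))
    -- (i) F and C are independent:
    (hind : ∀ c, ∀ᵐ y : ℝ, φF c y = fF y)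
    -- (ii) f_FX(y,x)·φ_X(c)(x) ≥ f_F(y)·(f_X(x))²:
    (hdom : ∀ c, ∀ᵐ z : ℝ × ℝ, fF z.1 * (fX z.2) ^ 2 ≤ fFX z.1 z.2 * φX c z.2) :
    ∃ δ : ℝ, 0 ≤ δ ∧
      -- I((F,C);X) ≥ I(F;C|X) + δ̃
      (1 - 2 * ∑ c, p c * ∫ z : ℝ × ℝ,
          φ c z.1 z.2 * φF c z.1 * fX z.2 / (φ c z.1 z.2 + φF c z.1 * fX z.2) ≥
        (1 - 2 * ∑ c, p c * ∫ z : ℝ × ℝ,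
          φ c z.1 z.2 * fFX z.1 z.2 * φX c z.2 /
            (φ c z.1 z.2 * fX z.2 + fFX z.1 z.2 * φX c z.2)) + δ) := by
  refine ⟨0, le_refl _, ?_⟩
  have hXnn : ∀ c x, 0 ≤ φX c x := fun c x => by
    rw [hφX]; exact integral_nonneg fun y => (hφpos c y x).le
  have hFnn : ∀ c y, 0 ≤ φF c y := fun c y => by
    rw [hφF]; exact integral_nonneg fun x => (hφpos c y x).le
  have hfXnn : ∀ x, 0 ≤ fX x := fun x => by
    rw [hfX]; exact Finset.sum_nonneg fun c _ => mul_nonneg (hp c).le (hXnn c x)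
  have hfFXnn : ∀ y x, 0 ≤ fFX y x := fun y x => by
    rw [hfFX]; exact Finset.sum_nonneg fun c _ => mul_nonneg (hp c).le (hφpos c y x).le
  have key : ∀ q a b s : ℝ, 0 < q → 0 ≤ a → 0 ≤ s → 0 ≤ b → a * s ≤ b → (s = 0 → a = 0) →
      q * a / (q + a) ≤ q * b / (q * s + b) := by
    intro q a b s hq ha hs hb hab hsa
    rcases hs.eq_or_lt with h | h
    · rw [hsa h.symm]
      simp only [mul_zero, zero_div]
      positivity
    · rw [div_le_div_iff₀ (by positivity) (by positivity)]
      nlinarith [mul_le_mul_of_nonneg_left hab (mul_pos hq hq).le]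
  have hle : ∀ c, (∫ z : ℝ × ℝ,
          φ c z.1 z.2 * φF c z.1 * fX z.2 / (φ c z.1 z.2 + φF c z.1 * fX z.2)) ≤
      ∫ z : ℝ × ℝ, φ c z.1 z.2 * fFX z.1 z.2 * φX c z.2 /
            (φ c z.1 z.2 * fX z.2 + fFX z.1 z.2 * φX c z.2) := by
    intro c
    apply integral_mono_ae (hI2 c) (hI4 c)
    have h1 : ∀ᵐ z : ℝ × ℝ, φF c z.1 = fF z.1 :=
      (Measure.quasiMeasurePreserving_fst (μ := (volume : Measure ℝ))
        (ν := (volume : Measure ℝ))).ae (hind c)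
    filter_upwards [h1, hdom c] with z hz hd
    have := key (φ c z.1 z.2) (φF c z.1 * fX z.2) (fFX z.1 z.2 * φX c z.2) (fX z.2)
      (hφpos _ _ _) (mul_nonneg (hFnn _ _) (hfXnn _)) (hfXnn _)
      (mul_nonneg (hfFXnn _ _) (hXnn _ _))
      (by rw [hz]; linarith) (by intro h; rw [h, mul_zero])
    simpa only [mul_assoc] using this
  have := Finset.sum_le_sum fun c (_ : c ∈ Finset.univ) =>
    mul_le_mul_of_nonneg_left (hle c) (hp c).le
  linarith
end

section
/- (Theorem 3.1, as established by its proof) Assume in addition to the setup in the context that (i) F and C are independent, i.e., φ_F(c)(y) = f_F(y) for every class c and a.e. y, and (ii) for every class c and a.e. (y,x) one has f_FX(y,x)·φ_X(c)(x) ≥ f_F(y)·(f_X(x))². Then I(F;X|C) + 2·Σ_c p(c) ∫∫ φ(c)(y,x)·φ_X(c)(x)/(f_X(x) + φ_X(c)(x)) dy dx ≥ I(F;C|X); in particular, if I(F;C|X) = 0, then I(F;X|C) ≥ −2·Σ_c p(c) ∫∫ φ(c)(y,x)·φ_X(c)(x)/(f_X(x) + φ_X(c)(x)) dy dx, i.e.,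 I(F;X|C) ≥ I((F,C);X) − 2·E_f[(f(X)/f(X|C) + 1)⁻¹] with I((F,C);X) ≥ I(F;C|X). -/
open MeasureTheory

theorem aux_two (a b q g : ℝ) (ha : 0 < a) (hb : 0 ≤ b) (hq : 0 ≤ q) (hg : 0 ≤ g) :
    a * b * q / (a + b * q) ≤ a * b * g / (a + b * g) + a * q / (g + q) := by
  rcases hq.eq_or_lt with rfl | hq
  · simp; positivity
  rw [div_add_div _ _ (by positivity) (by positivity), div_le_div_iff₀ (by positivity) (by positivity)]
  have : 0 ≤ a * (a ^ 2 * q + b * a * q * g + b ^ 2 * q ^ 2 * g + a * b * g ^ 2) := by positivity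
  nlinarith [this]

theorem aux_three (a b q g h : ℝ) (ha : 0 < a) (hb : 0 ≤ b) (hq : 0 ≤ q) (hg : 0 ≤ g)
    (hh : 0 ≤ h) (hd : b * g ^ 2 ≤ h * q) :
    a * b * g / (a + b * g) ≤ a * h * q / (a * g + h * q) := by
  rcases hg.eq_or_lt with rfl | hg
  · simp; positivity
  rw [div_le_div_iff₀ (by positivity) (by positivity)]
  nlinarith [mul_le_mul_of_nonneg_left hd (sq_nonneg a)]

/-- Theorem 3.1, as established by its proof: under (i) independence
of `F` and `C` and (ii) `f_FX(y,x)·φ_X(c)(x) ≥ f_F(y)·(f_X(x))²` a.e. for each `c`,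
one has `I(F;X|C) + 2·Σ_c p(c) ∫∫ φ(c)·φ_X(c)/(f_X + φ_X(c)) ≥ I(F;C|X)`;
in particular, if `I(F;C|X) = 0` then
`I(F;X|C) ≥ −2·Σ_c p(c) ∫∫ φ(c)·φ_X(c)/(f_X + φ_X(c))`, i.e.
`I(F;X|C) ≥ I((F,C);X) − 2·E_f[(f(X)/f(X|C)+1)⁻¹]` with `I((F,C);X) ≥ I(F;C|X)`. -/
theorem stmt_7
    (m : ℕ) (hm : 1 ≤ m)
    (p : Fin m → ℝ) (hp : ∀ c, 0 < p c) (hpsum : ∑ c, p c = 1)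
    (φ : Fin m → ℝ → ℝ → ℝ)
    (hφmeas : ∀ c, Measurable (Function.uncurry (φ c)))
    (hφpos : ∀ c y x, 0 < φ c y x)
    (hφint : ∀ c, ∫ z : ℝ × ℝ, φ c z.1 z.2 = 1)
    (hφinteg : ∀ c, Integrable (fun z : ℝ × ℝ => φ c z.1 z.2))
    (φF φX : Fin m → ℝ → ℝ)
    (hφF : ∀ c y, φF c y = ∫ x, φ c y x)
    (hφX : ∀ c x, φX c x = ∫ y, φ c y x)
    (fF : ℝ → ℝ) (hfF : ∀ y, fF y = ∑ c, p c * φF c y)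
    (fX : ℝ → ℝ) (hfX : ∀ x, fX x = ∑ c, p c * φX c x)
    (fFX : ℝ → ℝ → ℝ) (hfFX : ∀ y x, fFX y x = ∑ c, p c * φ c y x)
    -- all displayed integrals are finite:
    (hI1 : ∀ c, Integrable (fun z : ℝ × ℝ =>
      φ c z.1 z.2 * φF c z.1 * φX c z.2 / (φ c z.1 z.2 + φF c z.1 * φX c z.2)))
    (hI2 : ∀ c, Integrable (fun z : ℝ × ℝ =>
      φ c z.1 z.2 * φF c z.1 * fX z.2 / (φ c z.1 z.2 + φF c z.1 * fX z.2)))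
    (hI3 : ∀ c, Integrable (fun z : ℝ × ℝ =>
      φ c z.1 z.2 * φX c z.2 / (fX z.2 + φX c z.2)))
    (hI4 : ∀ c, Integrable (fun z : ℝ × ℝ =>
      φ c z.1 z.2 * fFX z.1 z.2 * φX c z.2 / (φ c z.1 z.2 * fX z.2 + fFX z.1 z.2 * φX c z.2)))
    -- (i) F and C are independent:
    (hind : ∀ c, ∀ᵐ y : ℝ, φF c y = fF y)
    -- (ii) f_FX(y,x)·φ_X(c)(x) ≥ f_F(y)·(f_X(x))²:
    (hdom : ∀ c, ∀ᵐ z : ℝ × ℝ, fF z.1 * (fX z.2) ^ 2 ≤ fFX z.1 z.2 * φX c z.2) :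
    -- I(F;X|C) + 2·Σ_c p(c)·∫∫ φ(c)·φ_X(c)/(f_X + φ_X(c)) ≥ I(F;C|X)
    ((1 - 2 * ∑ c, p c * ∫ z : ℝ × ℝ,
        φ c z.1 z.2 * φF c z.1 * φX c z.2 / (φ c z.1 z.2 + φF c z.1 * φX c z.2)) +
      2 * ∑ c, p c * ∫ z : ℝ × ℝ,
        φ c z.1 z.2 * φX c z.2 / (fX z.2 + φX c z.2) ≥
      1 - 2 * ∑ c, p c * ∫ z : ℝ × ℝ,
        φ c z.1 z.2 * fFX z.1 z.2 * φX c z.2 /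
          (φ c z.1 z.2 * fX z.2 + fFX z.1 z.2 * φX c z.2)) ∧
    -- I(F;X|C) ≥ I((F,C);X) − 2·E_f[(f(X)/f(X|C)+1)⁻¹]
    (1 - 2 * ∑ c, p c * ∫ z : ℝ × ℝ,
        φ c z.1 z.2 * φF c z.1 * φX c z.2 / (φ c z.1 z.2 + φF c z.1 * φX c z.2) ≥
      (1 - 2 * ∑ c, p c * ∫ z : ℝ × ℝ,
        φ c z.1 z.2 * φF c z.1 * fX z.2 / (φ c z.1 z.2 + φF c z.1 * fX z.2)) -
      2 * ∑ c, p c * ∫ z : ℝ × ℝ,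
        φ c z.1 z.2 * φX c z.2 / (fX z.2 + φX c z.2)) ∧
    -- I((F,C);X) ≥ I(F;C|X)
    (1 - 2 * ∑ c, p c * ∫ z : ℝ × ℝ,
        φ c z.1 z.2 * φF c z.1 * fX z.2 / (φ c z.1 z.2 + φF c z.1 * fX z.2) ≥
      1 - 2 * ∑ c, p c * ∫ z : ℝ × ℝ,
        φ c z.1 z.2 * fFX z.1 z.2 * φX c z.2 /
          (φ c z.1 z.2 * fX z.2 + fFX z.1 z.2 * φX c z.2)) ∧
    -- in particular: if I(F;C|X) = 0 then I(F;X|C) ≥ −2·Σ_c p(c)·∫∫ φ(c)·φ_X(c)/(f_X + φ_X(c))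
    ((1 - 2 * ∑ c, p c * ∫ z : ℝ × ℝ,
        φ c z.1 z.2 * fFX z.1 z.2 * φX c z.2 /
          (φ c z.1 z.2 * fX z.2 + fFX z.1 z.2 * φX c z.2) = 0) →
      1 - 2 * ∑ c, p c * ∫ z : ℝ × ℝ,
        φ c z.1 z.2 * φF c z.1 * φX c z.2 / (φ c z.1 z.2 + φF c z.1 * φX c z.2) ≥
      -(2 * ∑ c, p c * ∫ z : ℝ × ℝ,
        φ c z.1 z.2 * φX c z.2 / (fX z.2 + φX c z.2))) := by
  have hX0 : ∀ c x, 0 ≤ φX c x := fun c x => by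
    rw [hφX]; exact integral_nonneg fun y => (hφpos c y x).le
  have hF0 : ∀ c y, 0 ≤ φF c y := fun c y => by
    rw [hφF]; exact integral_nonneg fun x => (hφpos c y x).le
  have hg0 : ∀ x, 0 ≤ fX x := fun x => by
    rw [hfX]; exact Finset.sum_nonneg fun c _ => mul_nonneg (hp c).le (hX0 c x)
  have hh0 : ∀ y x, 0 ≤ fFX y x := fun y x => by
    rw [hfFX]; exact Finset.sum_nonneg fun c _ => mul_nonneg (hp c).le (hφpos c y x).le
  have key2 : ∀ c, ∫ z : ℝ × ℝ,
        φ c z.1 z.2 * φF c z.1 * φX c z.2 / (φ c z.1 z.2 + φF c z.1 * φX c z.2) ≤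
      (∫ z : ℝ × ℝ,
        φ c z.1 z.2 * φF c z.1 * fX z.2 / (φ c z.1 z.2 + φF c z.1 * fX z.2)) +
      ∫ z : ℝ × ℝ, φ c z.1 z.2 * φX c z.2 / (fX z.2 + φX c z.2) := by
    intro c
    rw [← integral_add (hI2 c) (hI3 c)]
    refine integral_mono (hI1 c) ((hI2 c).add (hI3 c)) fun z => ?_
    exact aux_two _ _ _ _ (hφpos c z.1 z.2) (hF0 c z.1) (hX0 c z.2) (hg0 z.2)
  have key3 : ∀ c, ∫ z : ℝ × ℝ,
        φ c z.1 z.2 * φF c z.1 * fX z.2 / (φ c z.1 z.2 + φF c z.1 * fX z.2) ≤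
      ∫ z : ℝ × ℝ,
        φ c z.1 z.2 * fFX z.1 z.2 * φX c z.2 /
          (φ c z.1 z.2 * fX z.2 + fFX z.1 z.2 * φX c z.2) := by
    intro c
    have h1 : ∀ᵐ z : ℝ × ℝ, φF c z.1 = fF z.1 :=
      (Measure.quasiMeasurePreserving_fst (μ := (volume : Measure ℝ))
        (ν := (volume : Measure ℝ))).ae (hind c)
    refine integral_mono_ae (hI2 c) (hI4 c) ?_
    filter_upwards [h1, hdom c] with z hz hd
    rw [← hz] at hd
    exact aux_three _ _ _ _ _ (hφpos c z.1 z.2) (hF0 c z.1) (hX0 c z.2) (hg0 z.2)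
      (hh0 z.1 z.2) hd
  have s2 := Finset.sum_le_sum fun c (_ : c ∈ Finset.univ) =>
    mul_le_mul_of_nonneg_left (key2 c) (hp c).le
  have s3 := Finset.sum_le_sum fun c (_ : c ∈ Finset.univ) =>
    mul_le_mul_of_nonneg_left (key3 c) (hp c).le
  simp only [mul_add, Finset.sum_add_distrib] at s2
  refine ⟨by linarith, by linarith, by linarith, fun h0 => by linarith⟩
end

section
/- The conditional geometric dependency measure is bounded: with the setup in the context, 0 ≤ G_ρ ≤ 1. (This is the boundedness property of the conditional geometric dependency measure on which the GOA algorithm's thresholding relies.) -/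
open MeasureTheory

/-- the conditional geometric dependency measure is bounded:
`0 ≤ G_ρ ≤ 1` where `G_ρ = 1 − 2·Σ_i Σ_j p(i)·p(j)·η_{ij}`. -/
theorem stmt_10
    (m : ℕ) (hm : 1 ≤ m)
    (p : Fin m → ℝ) (hp : ∀ i, 0 ≤ p i) (hpsum : ∑ i, p i = 1)
    (φ : Fin m → ℝ → ℝ → ℝ)
    (hφmeas : ∀ i, Measurable (Function.uncurry (φ i)))
    (hφnn : ∀ i x y, 0 ≤ φ i x y)
    (hφint : ∀ i, ∫ z : ℝ × ℝ, φ i z.1 z.2 = 1)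
    (hφinteg : ∀ i, Integrable (fun z : ℝ × ℝ => φ i z.1 z.2))
    (φX φY : Fin m → ℝ → ℝ)
    (hφX : ∀ i x, φX i x = ∫ y, φ i x y)
    (hφY : ∀ i y, φY i y = ∫ x, φ i x y)
    (hφXint : ∀ i, ∫ x, φX i x = 1)
    (hφYint : ∀ i, ∫ y, φY i y = 1)
    (f π : ℝ → ℝ → ℝ)
    (hf : ∀ x y, f x y = ∑ i, p i * φ i x y)
    (hπ : ∀ x y, π x y = ∑ i, p i * φX i x * φY i y)
    (hpos : ∀ᵐ z : ℝ × ℝ, 0 < f z.1 z.2 + π z.1 z.2)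
    (η : Fin m → Fin m → ℝ)
    (hη : ∀ i j, η i j = ∫ z : ℝ × ℝ,
      φ i z.1 z.2 * φX j z.1 * φY j z.2 / (f z.1 z.2 + π z.1 z.2))
    -- all displayed integrals are finite:
    (hηinteg : ∀ i j, Integrable (fun z : ℝ × ℝ =>
      φ i z.1 z.2 * φX j z.1 * φY j z.2 / (f z.1 z.2 + π z.1 z.2))) :
    0 ≤ 1 - 2 * ∑ i, ∑ j, p i * p j * η i j ∧
      1 - 2 * ∑ i, ∑ j, p i * p j * η i j ≤ 1 := by
  have hXi : ∀ i, Integrable (φX i) := fun i => by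
    by_contra h
    have := hφXint i
    rw [integral_undef h] at this
    norm_num at this
  have hYi : ∀ i, Integrable (φY i) := fun i => by
    by_contra h
    have := hφYint i
    rw [integral_undef h] at this
    norm_num at this
  have hXnn : ∀ i x, 0 ≤ φX i x := fun i x => by
    rw [hφX]; exact integral_nonneg (fun y => hφnn i x y)
  have hYnn : ∀ i y, 0 ≤ φY i y := fun i y => by
    rw [hφY]; exact integral_nonneg (fun x => hφnn i x y)
  have hfnn : ∀ x y, 0 ≤ f x y := fun x y => by
    rw [hf]; exact Finset.sum_nonneg (fun i _ => mul_nonneg (hp i) (hφnn i x y))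
  have hπnn : ∀ x y, 0 ≤ π x y := fun x y => by
    rw [hπ]
    exact Finset.sum_nonneg (fun i _ => mul_nonneg (mul_nonneg (hp i) (hXnn i x)) (hYnn i y))
  have hηnn : ∀ i j, 0 ≤ η i j := fun i j => by
    rw [hη]
    exact integral_nonneg (fun z => div_nonneg
      (mul_nonneg (mul_nonneg (hφnn _ _ _) (hXnn _ _)) (hYnn _ _))
      (add_nonneg (hfnn _ _) (hπnn _ _)))
  have hSnn : 0 ≤ ∑ i, ∑ j, p i * p j * η i j :=
    Finset.sum_nonneg (fun i _ => Finset.sum_nonneg (fun j _ =>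
      mul_nonneg (mul_nonneg (hp i) (hp j)) (hηnn i j)))
  have hprodi : ∀ i, Integrable (fun z : ℝ × ℝ => φX i z.1 * φY i z.2) := fun i =>
    (hXi i).mul_prod (hYi i)
  have hprod1 : ∀ i, ∫ z : ℝ × ℝ, φX i z.1 * φY i z.2 = 1 := fun i => by
    have := integral_prod_mul (μ := (volume : Measure ℝ)) (ν := (volume : Measure ℝ)) (φX i) (φY i)
    rw [hφXint, hφYint, mul_one] at this
    exact this
  have hfe : (fun z : ℝ × ℝ => f z.1 z.2) = fun z => ∑ i, p i * φ i z.1 z.2 := by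
    funext z; rw [hf]
  have hπe : (fun z : ℝ × ℝ => π z.1 z.2) = fun z => ∑ i, p i * (φX i z.1 * φY i z.2) := by
    funext z; rw [hπ]; simp only [mul_assoc]
  have hfi : Integrable (fun z : ℝ × ℝ => f z.1 z.2) := by
    rw [hfe]; exact integrable_finsetSum _ (fun i _ => (hφinteg i).const_mul _)
  have hπi : Integrable (fun z : ℝ × ℝ => π z.1 z.2) := by
    rw [hπe]; exact integrable_finsetSum _ (fun i _ => (hprodi i).const_mul _)
  have hf1 : ∫ z : ℝ × ℝ, f z.1 z.2 = 1 := by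
    rw [hfe, integral_finsetSum _ (fun i _ => (hφinteg i).const_mul _)]
    simp only [integral_const_mul, hφint, mul_one, hpsum]
  have hπ1 : ∫ z : ℝ × ℝ, π z.1 z.2 = 1 := by
    rw [hπe, integral_finsetSum _ (fun i _ => (hprodi i).const_mul _)]
    simp only [integral_const_mul, hprod1, mul_one, hpsum]
  have hSint : ∑ i, ∑ j, p i * p j * η i j = ∫ z : ℝ × ℝ, ∑ i, ∑ j, p i * p j *
      (φ i z.1 z.2 * φX j z.1 * φY j z.2 / (f z.1 z.2 + π z.1 z.2)) := by
    rw [integral_finsetSum _ (fun i _ => integrable_finsetSum _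
      (fun j _ => (hηinteg i j).const_mul _))]
    refine Finset.sum_congr rfl (fun i _ => ?_)
    rw [integral_finsetSum _ (fun j _ => (hηinteg i j).const_mul _)]
    refine Finset.sum_congr rfl (fun j _ => ?_)
    rw [integral_const_mul, hη]
  have hle : ∑ i, ∑ j, p i * p j * η i j ≤ ∫ z : ℝ × ℝ, (1/4 : ℝ) * (f z.1 z.2 + π z.1 z.2) := by
    rw [hSint]
    refine integral_mono_ae (integrable_finsetSum _ (fun i _ => integrable_finsetSum _
      (fun j _ => (hηinteg i j).const_mul _))) ((hfi.add hπi).const_mul _) ?_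
    filter_upwards [hpos] with z hz
    have e : ∑ i, ∑ j, p i * p j *
        (φ i z.1 z.2 * φX j z.1 * φY j z.2 / (f z.1 z.2 + π z.1 z.2))
        = f z.1 z.2 * π z.1 z.2 / (f z.1 z.2 + π z.1 z.2) := by
      generalize f z.1 z.2 + π z.1 z.2 = d
      rw [hf, hπ, Finset.sum_mul_sum, Finset.sum_div]
      refine Finset.sum_congr rfl (fun i _ => ?_)
      rw [Finset.sum_div]
      refine Finset.sum_congr rfl (fun j _ => ?_)
      ring
    show ∑ i, ∑ j, p i * p j *
        (φ i z.1 z.2 * φX j z.1 * φY j z.2 / (f z.1 z.2 + π z.1 z.2)) ≤ _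
    rw [e, div_le_iff₀ hz]
    show _ ≤ (1/4 : ℝ) * (f z.1 z.2 + π z.1 z.2) * (f z.1 z.2 + π z.1 z.2)
    nlinarith [sq_nonneg (f z.1 z.2 - π z.1 z.2)]
  rw [integral_const_mul, integral_add hfi hπi, hf1, hπ1] at hle
  constructor <;> linarith
end
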